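/- Let μ be a Radon measure on ℝⁿ (a Borel measure finite on compact sets), let 1 < q < ∞, let γ ≠ 0, and let 𝒞 be a finite collection of dyadic cubes in ℝⁿ. Then there is a constant C = C(γ,q) such that ‖∑_{Q∈𝒞} ℓ(Q)^{−γ/q} χ_Q‖_{L^q(ℝⁿ,μ)} ≤ C · (∑_{Q∈𝒞} ℓ(Q)^{−γ} μ(Q))^{1/q}, where χ_Q denotes the indicator function of Q. -/

import Mathlib

open MeasureTheory Set
open scoped ENNReal Classical

noncomputable section

/-- The half-open dyadic cube in `ℝⁿ` of generation `k` (sidelength `2 ^ k`) and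
corner index `j`, i.e. `∏ᵢ [jᵢ 2ᵏ, (jᵢ+1) 2ᵏ)`. -/
def dyadicCube (n : ℕ) (k : ℤ) (j : Fin n → ℤ) : Set (Fin n → ℝ) :=
  Set.univ.pi fun i => Set.Ico ((j i : ℝ) * 2 ^ k) (((j i : ℝ) + 1) * 2 ^ k)

/-- A finite sum of distinct integer powers of `r > 1` is controlled by its largest exponent. -/
theorem sum_zpow_le_of_forall_le {r : ℝ} (hr : 1 < r) (K : Finset ℤ) :
    ∀ m : ℤ, (∀ k ∈ K, k ≤ m) → ∑ k ∈ K, r ^ k ≤ r / (r - 1) * r ^ m := by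
  have h0 : 0 < r - 1 := by linarith
  have hr0 : 0 < r := by linarith
  induction K using Finset.induction_on_max with
  | empty => intro m _; simp only [Finset.sum_empty]; positivity
  | insert a s hs ih =>
    intro m hm
    rw [Finset.sum_insert (fun h => lt_irrefl _ (hs a h))]
    have h1 := ih (a - 1) fun k hk => by have := hs k hk; omega
    have h2 : r ^ a ≤ r ^ m := zpow_le_zpow_right₀ hr.le (hm a (Finset.mem_insert_self _ _))
    rw [zpow_sub_one₀ hr0.ne'] at h1
    calc r ^ a + ∑ k ∈ s, r ^ k ≤ r ^ a + r / (r - 1) * (r ^ a * r⁻¹) := by gcongr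
      _ = r / (r - 1) * r ^ a := by field_simp; ring
      _ ≤ r / (r - 1) * r ^ m := by gcongr

theorem rpow_sum_zpow_le_of_one_lt {r q : ℝ} (hr : 1 < r) (hq : 0 < q) (K : Finset ℤ) :
    (∑ k ∈ K, r ^ k) ^ q ≤ (r / (r - 1)) ^ q * ∑ k ∈ K, (r ^ k) ^ q := by
  have h0 : 0 < r - 1 := by linarith
  have hr0 : 0 < r := by linarith
  rcases K.eq_empty_or_nonempty with rfl | hK
  · simp [Real.zero_rpow hq.ne']
  calc (∑ k ∈ K, r ^ k) ^ q ≤ (r / (r - 1) * r ^ K.max' hK) ^ q := by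
        gcongr
        exact sum_zpow_le_of_forall_le hr K _ fun k hk => K.le_max' k hk
    _ = (r / (r - 1)) ^ q * (r ^ K.max' hK) ^ q :=
        Real.mul_rpow (by positivity) (by positivity)
    _ ≤ (r / (r - 1)) ^ q * ∑ k ∈ K, (r ^ k) ^ q := by
        gcongr
        exact Finset.single_le_sum (f := fun k => (r ^ k) ^ q) (fun k _ => by positivity)
          (K.max'_mem hK)

/-- For finite sums of distinct integer powers of `r ≠ 1`, the `ℓ¹` and `ℓ^q` norms are
comparable. -/
theorem exists_rpow_sum_zpow_le {r q : ℝ} (hr0 : 0 < r) (hr : r ≠ 1) (hq : 0 < q) :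
    ∃ D : ℝ, 0 < D ∧ ∀ K : Finset ℤ,
      (∑ k ∈ K, r ^ k) ^ q ≤ D ^ q * ∑ k ∈ K, (r ^ k) ^ q := by
  rcases lt_or_gt_of_ne hr with h | h
  · have h1 : 1 < r⁻¹ := (one_lt_inv₀ hr0).2 h
    refine ⟨r⁻¹ / (r⁻¹ - 1), div_pos (by positivity) (by linarith), fun K => ?_⟩
    simpa using rpow_sum_zpow_le_of_one_lt h1 hq (K.map (Equiv.neg ℤ).toEmbedding)
  · exact ⟨r / (r - 1), div_pos hr0 (by linarith), rpow_sum_zpow_le_of_one_lt h hq⟩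

theorem measurableSet_dyadicCube (n : ℕ) (k : ℤ) (j : Fin n → ℤ) :
    MeasurableSet (dyadicCube n k j) :=
  MeasurableSet.univ_pi fun _ => measurableSet_Ico

/-- A point lies in at most one dyadic cube of each generation. -/
theorem eq_of_mem_dyadicCube {n : ℕ} {k : ℤ} {j j' : Fin n → ℤ} {x : Fin n → ℝ}
    (h : x ∈ dyadicCube n k j) (h' : x ∈ dyadicCube n k j') : j = j' := by
  have key : ∀ {a b : Fin n → ℤ}, x ∈ dyadicCube n k a → x ∈ dyadicCube n k b →
      ∀ i, a i ≤ b i := by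
    intro a b ha hb i
    have h1 := (ha i (Set.mem_univ i)).1
    have h2 := (hb i (Set.mem_univ i)).2
    have h3 : (a i : ℝ) < b i + 1 :=
      lt_of_mul_lt_mul_right (h1.trans_lt h2) (by positivity)
    exact Int.lt_add_one_iff.1 (by exact_mod_cast h3)
  exact funext fun i => le_antisymm (key h h' i) (key h' h i)

theorem sum_mul_indicator_dyadicCube {n : ℕ} (𝓒 : Finset (ℤ × (Fin n → ℤ))) (f : ℤ → ℝ)
    (x : Fin n → ℝ) :
    ∑ Q ∈ 𝓒, f Q.1 * (dyadicCube n Q.1 Q.2).indicator (fun _ => (1 : ℝ)) x =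
      ∑ k ∈ (𝓒.filter fun Q => x ∈ dyadicCube n Q.1 Q.2).image Prod.fst, f k := by
  rw [Finset.sum_image, Finset.sum_filter]
  · simp [Set.indicator_apply]
  · rintro ⟨k, j⟩ hQ ⟨k', j'⟩ hQ' (rfl : k = k')
    simp only [Finset.mem_coe, Finset.mem_filter] at hQ hQ'
    rw [eq_of_mem_dyadicCube hQ.2 hQ'.2]

/-- for a Radon measure `μ`, `1 < q < ∞`, `γ ≠ 0` and a finite collection `𝒞`
of dyadic cubes, `‖∑_{Q∈𝒞} ℓ(Q)^{-γ/q} χ_Q‖_{L^q(μ)} ≤ C (∑_{Q∈𝒞} ℓ(Q)^{-γ} μ(Q))^{1/q}`. -/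
theorem statement6 (n : ℕ) (q γ : ℝ) (hq : 1 < q) (hγ : γ ≠ 0) :
    ∃ C : ℝ, 0 < C ∧
      ∀ (μ : Measure (Fin n → ℝ)), IsFiniteMeasureOnCompacts μ →
      ∀ (𝓒 : Finset (ℤ × (Fin n → ℤ))),
      (∫⁻ x, ENNReal.ofReal
          ((∑ Q ∈ 𝓒, ((2 : ℝ) ^ Q.1) ^ (-γ / q) *
            (dyadicCube n Q.1 Q.2).indicator (fun _ => (1 : ℝ)) x) ^ q) ∂μ) ^ (1 / q)
        ≤ ENNReal.ofReal C *
          (∑ Q ∈ 𝓒, ENNReal.ofReal (((2 : ℝ) ^ Q.1) ^ (-γ)) * μ (dyadicCube n Q.1 Q.2))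
            ^ (1 / q) := by
  have hq0 : 0 < q := by linarith
  have hr0 : (0 : ℝ) < 2 ^ (-γ / q) := by positivity
  have hr1 : (2 : ℝ) ^ (-γ / q) ≠ 1 := by
    rw [← Real.rpow_zero 2, Ne, Real.rpow_right_inj two_pos (by norm_num)]
    exact div_ne_zero (neg_ne_zero.2 hγ) hq0.ne'
  obtain ⟨D, hD, hsum⟩ := exists_rpow_sum_zpow_le hr0 hr1 hq0
  have hpow (k : ℤ) : ((2 : ℝ) ^ k) ^ (-γ / q) = ((2 : ℝ) ^ (-γ / q)) ^ k := by
    rw [← Real.rpow_intCast, ← Real.rpow_intCast, ← Real.rpow_mul (by norm_num),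
      ← Real.rpow_mul (by norm_num), mul_comm]
  have hpow' (k : ℤ) : (((2 : ℝ) ^ (-γ / q)) ^ k) ^ q = ((2 : ℝ) ^ k) ^ (-γ) := by
    rw [← hpow, ← Real.rpow_mul (by positivity), div_mul_cancel₀ _ hq0.ne']
  refine ⟨D, hD, fun μ _ 𝓒 => ?_⟩
  have hpt (x : Fin n → ℝ) :
      (∑ Q ∈ 𝓒, ((2 : ℝ) ^ Q.1) ^ (-γ / q) *
        (dyadicCube n Q.1 Q.2).indicator (fun _ => (1 : ℝ)) x) ^ q ≤
      D ^ q * ∑ Q ∈ 𝓒, ((2 : ℝ) ^ Q.1) ^ (-γ) *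
        (dyadicCube n Q.1 Q.2).indicator (fun _ => (1 : ℝ)) x := by
    rw [sum_mul_indicator_dyadicCube 𝓒 (fun k => ((2 : ℝ) ^ k) ^ (-γ / q)),
      sum_mul_indicator_dyadicCube 𝓒 (fun k => ((2 : ℝ) ^ k) ^ (-γ))]
    simp only [hpow, ← hpow']
    exact hsum _
  have hind (Q : ℤ × (Fin n → ℤ)) (x : Fin n → ℝ) :
      ENNReal.ofReal (((2 : ℝ) ^ Q.1) ^ (-γ) *
        (dyadicCube n Q.1 Q.2).indicator (fun _ => (1 : ℝ)) x) =
      (dyadicCube n Q.1 Q.2).indicator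
        (fun _ => ENNReal.ofReal (((2 : ℝ) ^ Q.1) ^ (-γ))) x := by
    by_cases hx : x ∈ dyadicCube n Q.1 Q.2 <;> simp [hx]
  have hint : ∫⁻ x, ENNReal.ofReal
      ((∑ Q ∈ 𝓒, ((2 : ℝ) ^ Q.1) ^ (-γ / q) *
        (dyadicCube n Q.1 Q.2).indicator (fun _ => (1 : ℝ)) x) ^ q) ∂μ ≤
      ENNReal.ofReal (D ^ q) *
        ∑ Q ∈ 𝓒, ENNReal.ofReal (((2 : ℝ) ^ Q.1) ^ (-γ)) * μ (dyadicCube n Q.1 Q.2) := by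
    refine (lintegral_mono fun x => ENNReal.ofReal_le_ofReal (hpt x)).trans_eq ?_
    have hnonneg (x : Fin n → ℝ) (Q : ℤ × (Fin n → ℤ)) : 0 ≤ ((2 : ℝ) ^ Q.1) ^ (-γ) *
        (dyadicCube n Q.1 Q.2).indicator (fun _ => (1 : ℝ)) x :=
      mul_nonneg (by positivity) (Set.indicator_nonneg (fun _ _ => zero_le_one) x)
    simp_rw [ENNReal.ofReal_mul (Real.rpow_nonneg hD.le q),
      ENNReal.ofReal_sum_of_nonneg (fun Q _ => hnonneg _ Q), hind]
    rw [lintegral_const_mul' _ _ ENNReal.ofReal_ne_top, lintegral_finsetSum _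
      fun Q _ => measurable_const.indicator (measurableSet_dyadicCube n Q.1 Q.2)]
    simp_rw [lintegral_indicator_const (measurableSet_dyadicCube n _ _)]
  calc _ ≤ _ := ENNReal.rpow_le_rpow hint (by positivity)
    _ = _ := by
      rw [ENNReal.mul_rpow_of_nonneg _ _ (by positivity),
        ENNReal.ofReal_rpow_of_nonneg (by positivity) (by positivity), ← Real.rpow_mul hD.le,
        mul_one_div_cancel hq0.ne', Real.rpow_one]
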